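/- Let k = ⊕_{i≤0} k^i be a differential graded Lie algebra over a field of characteristic zero, with differential ∂ of degree +1, bounded below (k^i = 0 for i << 0), and H(k) = 0. Then for any even central cocycle X ∈ k (the center of k, with ∂X = 0), there exists an odd element f ∈ k⁻ = ⊕_{i<0} k^i solving the inhomogeneous Maurer-Cartan equation ∂f + (1/2)[f,f] = X. -/

import Mathlib

set_option maxHeartbeats 1000000
set_option synthInstance.maxHeartbeats 400000

noncomputable section

/-- A differential graded Lie algebra over `𝕜`, concentrated in non-positive degrees and
bounded below, presented internally: `K` is the underlying space, `piece i` its degree-`i`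
component, `br` the (graded) Lie bracket and `d` the differential of degree `+1`, which is a
derivation of the bracket; the sign axioms are imposed on homogeneous elements. -/
structure NegDGLA (𝕜 K : Type*) [Field 𝕜] [AddCommGroup K] [Module 𝕜 K] where
  piece : ℤ → Submodule 𝕜 K
  internal : DirectSum.IsInternal piece
  bounded : ∃ N : ℤ, ∀ i < N, piece i = ⊥
  nonpos : ∀ i > 0, piece i = ⊥
  br : K →ₗ[𝕜] K →ₗ[𝕜] K
  d : Module.End 𝕜 K
  br_grade : ∀ i j x y, x ∈ piece i → y ∈ piece j → br x y ∈ piece (i + j)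
  d_grade : ∀ i x, x ∈ piece i → d x ∈ piece (i + 1)
  d_sq : d ∘ₗ d = 0
  skew : ∀ i j x y, x ∈ piece i → y ∈ piece j →
    br x y = -(((-1 : 𝕜) ^ (i * j)) • br y x)
  jacobi : ∀ i j x y z, x ∈ piece i → y ∈ piece j →
    br x (br y z) = br (br x y) z + ((-1 : 𝕜) ^ (i * j)) • br y (br x z)
  leibniz : ∀ i x y, x ∈ piece i →
    d (br x y) = br (d x) y + ((-1 : 𝕜) ^ i) • br x (d y)

namespace NegDGLA

variable {𝕜 K : Type*} [Field 𝕜] [AddCommGroup K] [Module 𝕜 K] (D : NegDGLA 𝕜 K)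

/-- The even part `⊕_i k^{2i}`. -/
def evenPart : Submodule 𝕜 K := ⨆ i : ℤ, D.piece (2 * i)

/-- The odd part of `k⁻ = ⊕_{i<0} k^i`. -/
def oddNeg : Submodule 𝕜 K := ⨆ (i : ℤ) (_ : i < 0) (_ : Odd i), D.piece i

/-- The even part of `k⁻ = ⊕_{i<0} k^i`. -/
def evenNeg : Submodule 𝕜 K := ⨆ (i : ℤ) (_ : i < 0) (_ : Even i), D.piece i

/-- The center of `k`: elements bracketing to zero with everything. -/
def center : Submodule 𝕜 K := ⨅ y : K, LinearMap.ker (D.br.flip y)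

end NegDGLA

namespace NegDGLA

variable {𝕜 K : Type*} [Field 𝕜] [AddCommGroup K] [Module 𝕜 K] (D : NegDGLA 𝕜 K)

/-- Sum of the pieces whose degree satisfies `P`. -/
def part (P : ℤ → Prop) : Submodule 𝕜 K := ⨆ (i : ℤ) (_ : P i), D.piece i

theorem piece_le_part {P : ℤ → Prop} {i : ℤ} (h : P i) : D.piece i ≤ D.part P :=
  le_iSup₂_of_le i h le_rfl

theorem part_le {P : ℤ → Prop} {S : Submodule 𝕜 K} (h : ∀ i, P i → D.piece i ≤ S) :
    D.part P ≤ S := iSup₂_le h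

theorem part_mono {P Q : ℤ → Prop} (h : ∀ i, P i → Q i) : D.part P ≤ D.part Q :=
  D.part_le fun i hi => D.piece_le_part (h i hi)

theorem part_true (x : K) : x ∈ D.part (fun _ => True) := by
  have h := D.internal.submodule_iSup_eq_top
  have : x ∈ ⨆ i, D.piece i := by rw [h]; trivial
  exact (iSup_le fun i => D.piece_le_part (P := fun _ => True) trivial) this

theorem eq_zero_of_part {P : ℤ → Prop} {i : ℤ} (hi : ¬ P i) {x : K} (hx : x ∈ D.piece i)
    (hx' : x ∈ D.part P) : x = 0 := by
  have h := D.internal.submodule_iSupIndep i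
  rw [Submodule.disjoint_def] at h
  refine h x hx ?_
  refine D.part_le (P := P) (fun j hj => ?_) hx'
  refine le_iSup₂_of_le j ?_ le_rfl
  rintro rfl
  exact hi hj

theorem d_part {P Q : ℤ → Prop} (h : ∀ i, P i → Q (i + 1)) {x : K} (hx : x ∈ D.part P) :
    D.d x ∈ D.part Q := by
  have : D.part P ≤ (D.part Q).comap D.d :=
    D.part_le fun i hi y hy => D.piece_le_part (h i hi) (D.d_grade i y hy)
  exact this hx

theorem br_part {P Q R : ℤ → Prop} (h : ∀ i j, P i → Q j → R (i + j)) {x y : K}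
    (hx : x ∈ D.part P) (hy : y ∈ D.part Q) : D.br x y ∈ D.part R := by
  have h1 : ∀ i, P i → ∀ a ∈ D.piece i, D.br a y ∈ D.part R := by
    intro i hi a ha
    have : D.part Q ≤ (D.part R).comap (D.br a) :=
      D.part_le fun j hj b hb => D.piece_le_part (h i j hi hj) (D.br_grade i j a b ha hb)
    exact this hy
  have : D.part P ≤ (D.part R).comap (D.br.flip y) :=
    D.part_le fun i hi a ha => h1 i hi a ha
  exact this hx

theorem part_split {P Q : ℤ → Prop} (i : ℤ) (h : ∀ j, P j → j = i ∨ Q j) {x : K}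
    (hx : x ∈ D.part P) : ∃ a ∈ D.piece i, ∃ b ∈ D.part Q, a + b = x := by
  have : D.part P ≤ D.piece i ⊔ D.part Q := by
    refine D.part_le fun j hj => ?_
    rcases h j hj with rfl | h
    · exact le_sup_left
    · exact (D.piece_le_part h).trans le_sup_right
  exact Submodule.mem_sup.1 (this hx)

theorem bilin_eq {V : Type*} [AddCommGroup V] [Module 𝕜 V] {P Q : ℤ → Prop}
    (B : K →ₗ[𝕜] K →ₗ[𝕜] V)
    (h : ∀ i j x y, P i → Q j → x ∈ D.piece i → y ∈ D.piece j → B x y = 0) {x y : K}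
    (hx : x ∈ D.part P) (hy : y ∈ D.part Q) : B x y = 0 := by
  have h1 : ∀ i, P i → ∀ a ∈ D.piece i, B a y = 0 := by
    intro i hi a ha
    have : D.part Q ≤ LinearMap.ker (B a) :=
      D.part_le fun j hj b hb => h i j a b hi hj ha hb
    exact this hy
  have : D.part P ≤ LinearMap.ker (B.flip y) :=
    D.part_le fun i hi a ha => h1 i hi a ha
  exact this hx

theorem skew_odd {x y : K} (hx : x ∈ D.part Odd) (hy : y ∈ D.part Odd) :
    D.br x y = D.br y x := by
  have := D.bilin_eq (D.br - D.br.flip) (P := Odd) (Q := Odd) (fun i j x y hi hj hx hy => by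
    have := D.skew i j x y hx hy
    rw [(hi.mul hj).neg_one_zpow] at this
    simp [this]) hx hy
  simpa [sub_eq_zero] using this

theorem skew_even {x y : K} (hx : x ∈ D.part Even) (hy : y ∈ D.part Odd) :
    D.br x y = - D.br y x := by
  have := D.bilin_eq (D.br + D.br.flip) (P := Even) (Q := Odd) (fun i j x y hi hj hx hy => by
    have := D.skew i j x y hx hy
    rw [(hi.mul_right j).neg_one_zpow] at this
    simp [this]) hx hy
  simpa [eq_neg_iff_add_eq_zero] using this

theorem leib_odd {x y : K} (hx : x ∈ D.part Odd) :
    D.d (D.br x y) = D.br (D.d x) y - D.br x (D.d y) := by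
  have : D.part Odd ≤ LinearMap.ker
      (D.d ∘ₗ D.br.flip y - D.br.flip y ∘ₗ D.d + D.br.flip (D.d y)) :=
    D.part_le fun i hi a ha => by
      have := D.leibniz i a y ha
      rw [hi.neg_one_zpow] at this
      simp [this]
  have := this hx
  simp at this
  rw [← sub_eq_zero, ← this]; abel

theorem jac_odd {x y z : K} (hx : x ∈ D.part Odd) (hy : y ∈ D.part Odd) :
    D.br x (D.br y z) = D.br (D.br x y) z - D.br y (D.br x z) := by
  have := D.bilin_eq (P := Odd) (Q := Odd)
    ((D.br.compl₂ (D.br.flip z)) - D.br.compr₂ (D.br.flip z)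
      + (D.br.compl₂ (D.br.flip z)).flip) (fun i j x y hi hj hx hy => by
    have := D.jacobi i j x y z hx hy
    rw [(hi.mul hj).neg_one_zpow] at this
    simp [this]) hx hy
  simp at this
  rw [← sub_eq_zero, ← this]; abel

theorem triple [CharZero 𝕜] {f : K} (hf : f ∈ D.part Odd) : D.br (D.br f f) f = 0 := by
  have h1 := D.jac_odd (z := f) hf hf
  have h2 := D.skew_even (D.br_part (R := Even) (fun i j hi hj => hi.add_odd hj) hf hf) hf
  have h3 : (3 : 𝕜) • D.br f (D.br f f) = 0 := by
    rw [h2] at h1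
    have : (3 : 𝕜) • D.br f (D.br f f) = D.br f (D.br f f) + D.br f (D.br f f)
      + D.br f (D.br f f) := by module
    rw [this]; nth_rewrite 1 [h1]; abel
  rw [h2, (smul_eq_zero.1 h3).resolve_left (by norm_num), neg_zero]

/-- Odd negative degrees. -/
def ON (i : ℤ) : Prop := i < 0 ∧ Odd i

/-- Even degrees bounded above by `-2n`. -/
def EB (n : ℕ) (i : ℤ) : Prop := i ≤ -2 * n ∧ Even i

theorem residual_d [CharZero 𝕜] {X f R : K} (hXc : X ∈ D.center) (hX : D.d X = 0)
    (hf : f ∈ D.part Odd) (hR : R = X - D.d f - (2 : 𝕜)⁻¹ • D.br f f) :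
    D.d R = D.br R f := by
  have hdd : D.d (D.d f) = 0 := LinearMap.congr_fun D.d_sq f
  have hXf : D.br X f = 0 := by
    have := (Submodule.mem_iInf _).1 hXc f
    simpa using this
  have hdf : D.d f ∈ D.part Even := D.d_part (fun i hi => hi.add_odd odd_one) hf
  have h := D.skew_even hdf hf
  have hl := D.leib_odd (y := f) hf
  have ht := D.triple hf
  rw [hR]
  simp only [map_sub, map_smul, LinearMap.sub_apply, LinearMap.smul_apply, hX, hdd, hXf, ht, hl]
  have : D.br f (D.d f) = - D.br (D.d f) f := by rw [h, neg_neg]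
  rw [this, sub_neg_eq_add, ← two_smul 𝕜, smul_smul]
  simp

theorem step [CharZero 𝕜] (hac : LinearMap.ker D.d ≤ LinearMap.range D.d)
    {X f : K} (hXc : X ∈ D.center) (hX : D.d X = 0) (n : ℕ) (hf : f ∈ D.part ON)
    (hR : X - D.d f - (2 : 𝕜)⁻¹ • D.br f f ∈ D.part (EB n)) :
    ∃ f' ∈ D.part ON, X - D.d f' - (2 : 𝕜)⁻¹ • D.br f' f' ∈ D.part (EB (n + 1)) := by
  have hfo : f ∈ D.part Odd := D.part_mono (fun i hi => hi.2) hf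
  have hdR := D.residual_d hXc hX hfo rfl
  set R := X - D.d f - (2 : 𝕜)⁻¹ • D.br f f with hRdef
  obtain ⟨r, hr, s, hs, hrs⟩ := D.part_split (Q := EB (n + 1)) (-2 * n) (fun j hj => by
    obtain ⟨h1, k, hk⟩ := hj
    by_cases h : j = -2 * n
    · exact Or.inl h
    · refine Or.inr ⟨?_, k, hk⟩
      push_cast
      omega) hR
  have hdr : D.d r = 0 := by
    refine D.eq_zero_of_part (P := fun i => i ≤ -2 * n - 1) (i := -2 * n + 1) (by omega)
      (D.d_grade _ _ hr) ?_
    have : D.d r = D.br R f - D.d s := by rw [← hdR, ← hrs, map_add]; abel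
    rw [this]
    refine sub_mem (D.br_part (fun i j hi hj => ?_) hR hf) (D.d_part (fun i hi => ?_) hs)
    · have := hi.1; have := hj.1; omega
    · have := hi.1; push_cast at this; omega
  obtain ⟨h, hh⟩ := hac (LinearMap.mem_ker.2 hdr)
  obtain ⟨g, hg, t, ht, hgt⟩ := D.part_split (Q := fun j => j ≠ -2 * n - 1) (-2 * n - 1)
    (fun j _ => em _) (D.part_true h)
  have hdg : D.d g = r := by
    rw [← sub_eq_zero]
    refine D.eq_zero_of_part (P := fun i => i ≠ -2 * n) (i := -2 * n) (by simp) ?_ ?_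
    · refine sub_mem ?_ hr
      have := D.d_grade _ _ hg
      rwa [sub_add_cancel] at this
    · have : D.d g - r = - D.d t := by rw [← hh, ← hgt, map_add]; abel
      rw [this]
      exact neg_mem (D.d_part (fun i hi => by omega) ht)
  have hodd : Odd (-2 * (n : ℤ) - 1) := ⟨-n - 1, by ring⟩
  have hg' : g ∈ D.part (fun i => i = -2 * n - 1) := D.piece_le_part (P := fun i => i = -2 * n - 1) rfl hg
  have hgo : g ∈ D.part Odd := D.piece_le_part hodd hg
  have hgn : g ∈ D.part ON := D.piece_le_part ⟨by omega, hodd⟩ hg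
  refine ⟨f + g, add_mem hf hgn, ?_⟩
  have key : X - D.d (f + g) - (2 : 𝕜)⁻¹ • D.br (f + g) (f + g)
      = s - (D.br f g + (2 : 𝕜)⁻¹ • D.br g g) := by
    have e : s = X - D.d f - (2 : 𝕜)⁻¹ • D.br f f - D.d g := by
      rw [hdg, ← hRdef, ← hrs]; abel
    rw [e]
    simp only [map_add, LinearMap.add_apply, D.skew_odd hgo hfo, smul_add]
    have : D.br f g = (2 : 𝕜)⁻¹ • D.br f g + (2 : 𝕜)⁻¹ • D.br f g := by
      rw [← add_smul, ← two_mul, mul_inv_cancel₀ two_ne_zero, one_smul]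
    nth_rewrite 3 [this]
    abel
  rw [key]
  have aux : ∀ i j : ℤ, ON i → j = -2 * n - 1 → EB (n + 1) (i + j) := by
    rintro i j ⟨h1, h2⟩ rfl
    refine ⟨?_, h2.add_odd hodd⟩
    push_cast; omega
  exact sub_mem hs (add_mem (D.br_part aux hf hg')
    (Submodule.smul_mem _ _ (D.br_part aux hgn hg')))

end NegDGLA

/-- In a bounded-below acyclic differential graded Lie algebra concentrated in non-positive
degrees, for any even central cocycle `X` the inhomogeneous Maurer-Cartan equation
`∂f + ½[f,f] = X` has an odd solution `f ∈ k⁻`. -/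
theorem mc_solution_exists {𝕜 K : Type*} [Field 𝕜] [CharZero 𝕜]
    [AddCommGroup K] [Module 𝕜 K] (D : NegDGLA 𝕜 K)
    (hacyclic : LinearMap.ker D.d ≤ LinearMap.range D.d)
    (X : K) (hXeven : X ∈ D.evenPart) (hXcentral : X ∈ D.center) (hXcocycle : D.d X = 0) :
    ∃ f ∈ D.oddNeg, D.d f + (2 : 𝕜)⁻¹ • D.br f f = X := by
  have key : ∀ n : ℕ, ∃ f ∈ D.part NegDGLA.ON,
      X - D.d f - (2 : 𝕜)⁻¹ • D.br f f ∈ D.part (NegDGLA.EB n) := by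
    intro n
    induction n with
    | zero =>
      refine ⟨0, zero_mem _, ?_⟩
      have : D.evenPart ≤ D.part (NegDGLA.EB 0) := by
        refine iSup_le fun i => ?_
        by_cases hi : 2 * i > 0
        · rw [D.nonpos _ hi]; exact bot_le
        · exact D.piece_le_part ⟨by simp; omega, even_two_mul i⟩
      simpa using this hXeven
    | succ n ih =>
      obtain ⟨f, hf, hR⟩ := ih
      exact D.step hacyclic hXcentral hXcocycle n hf hR
  obtain ⟨N, hN⟩ := D.bounded
  obtain ⟨f, hf, hR⟩ := key (N.natAbs + 1)
  refine ⟨f, ?_, ?_⟩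
  · refine D.part_le (fun i hi => ?_) hf
    exact le_iSup_of_le i (le_iSup_of_le hi.1 (le_iSup_of_le hi.2 le_rfl))
  · have h0 : D.part (NegDGLA.EB (N.natAbs + 1)) ≤ ⊥ := by
      refine D.part_le fun i hi => ?_
      rw [hN i (by have := hi.1; omega)]
    have := (Submodule.mem_bot 𝕜).1 (h0 hR)
    rw [sub_sub, sub_eq_zero] at this
    exact this.symm
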